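/- arXiv:2409.14174 — 2 statements merged into one kernel-verified Lean document; each statement's English description precedes it below -/
import Mathlib

section
/- Let j ≥ 0 be an integer. There exists a constant C > 0 depending only on j such that for all integers n, s ≥ 1 with s ≤ n, every 0 < τ ≤ n^{−4j−5}, and every polynomial p ∈ P_s: Σ_{k'=1}^{n} ∫_{A_{k'}} | Σ_{k ≠ k', 1 ≤ k ≤ n} ψ_{j,t_{k−1},p}(t) T_{τ,t_{k−1},t_k}(t) |² dt ≤ C · n^{−2j−2} · ‖p‖²_{L²(I)}. -/
open MeasureTheory

/-- The ReLU function. -/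
noncomputable def relu (t : ℝ) : ℝ := max t 0

/-- The trapezoid function `T_{τ,a,b}`. -/
noncomputable def trap (τ a b t : ℝ) : ℝ :=
  τ⁻¹ * (relu (t - a + τ) - relu (t - a) - relu (t - b) + relu (t - b - τ))

/-- The interval `I = [−1/2, 1/2]`. -/
def II : Set ℝ := Set.Icc (-(1/2)) (1/2)

/-- The grid point `t_k = −1/2 + k/n`. -/
noncomputable def tk (n k : ℕ) : ℝ := -(1/2) + (k : ℝ) / (n : ℝ)

/-- The cell `A_k = [t_{k−1}, t_k)` for `k < n` and `A_n = [t_{n−1}, t_n]`. -/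
noncomputable def Ak (n k : ℕ) : Set ℝ :=
  if k = n then Set.Icc (tk n (k - 1)) (tk n k) else Set.Ico (tk n (k - 1)) (tk n k)

/-- The degree-`j` Taylor polynomial `ψ_{j,a,p}` of a polynomial `p` at `a`. -/
noncomputable def psiP (j : ℕ) (a : ℝ) (p : Polynomial ℝ) (t : ℝ) : ℝ :=
  ∑ i ∈ Finset.range (j + 1),
    (Polynomial.derivative^[i] p).eval a * (t - a) ^ i / (i.factorial : ℝ)


lemma markov_endpoint (P : Polynomial ℝ) (n : ℕ) (hdeg : P.natDegree ≤ n) (M : ℝ) (hM : 0 < M)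
    (hP : ∀ x ∈ Set.Icc (-1 : ℝ) 1, |P.eval x| ≤ M) :
    |P.derivative.eval 1| ≤ (n : ℝ) ^ 2 * M := by
  have key : ∀ Q : Polynomial ℝ, Q.natDegree ≤ n → (∀ x ∈ Set.Icc (-1 : ℝ) 1, |Q.eval x| ≤ M) →
      Q.derivative.eval 1 ≤ (n : ℝ) ^ 2 * M := by
    intro Q hQ hb
    have h := Polynomial.Chebyshev.eval_iterate_derivative_le_of_forall_abs_le_one
      (n := n) (P := Polynomial.C M⁻¹ * Q) (k := 1) (x := 1) le_rfl
      (by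
        refine Polynomial.natDegree_le_iff_degree_le.mp ?_
        exact (Polynomial.natDegree_C_mul_le _ _).trans hQ)
      (by
        intro x hx
        rw [Polynomial.eval_mul, Polynomial.eval_C, abs_mul, abs_of_pos (inv_pos.mpr hM)]
        have := hb x hx
        rw [inv_mul_le_iff₀ hM]; linarith)
    simp only [Function.iterate_one, Polynomial.derivative_mul, Polynomial.derivative_C, zero_mul,
      zero_add, Polynomial.eval_mul, Polynomial.eval_C,
      Polynomial.Chebyshev.derivative_T_eval_one] at h
    rw [inv_mul_le_iff₀ hM] at h
    push_cast at h
    linarith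
  rw [abs_le]
  constructor
  · have := key (-P) (by simpa using hdeg) (by intro x hx; simpa using hP x hx)
    simp at this
    linarith
  · exact key P hdeg hP

lemma markov_II (p : Polynomial ℝ) (n : ℕ) (hdeg : p.natDegree ≤ n) (M : ℝ) (hM : 0 < M)
    (hP : ∀ x ∈ II, |p.eval x| ≤ M) : ∀ x ∈ II, |p.derivative.eval x| ≤ 4 * (n : ℝ) ^ 2 * M := by
  have key : ∀ c x : ℝ, |c| = 1 / 4 → (∀ y ∈ Set.Icc (-1 : ℝ) 1, c * y + (x - c) ∈ II) →
      |p.derivative.eval x| ≤ 4 * (n : ℝ) ^ 2 * M := by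
    intro c x hc hI
    have h := markov_endpoint (p.comp (Polynomial.C c * Polynomial.X + Polynomial.C (x - c))) n
      (by
        refine (Polynomial.natDegree_comp_le).trans ?_
        calc _ ≤ p.natDegree * 1 := Nat.mul_le_mul_left _ (Polynomial.natDegree_linear_le)
          _ ≤ n := by simpa using hdeg) M hM
      (by
        intro y hy
        have := hP _ (hI y hy)
        simpa using this)
    rw [Polynomial.derivative_comp] at h
    simp at h
    rw [hc] at h
    linarith
  intro x hx
  simp only [II, Set.mem_Icc] at hx ⊢
  rcases le_total 0 x with h0 | h0
  · refine key (1/4) x (by norm_num) ?_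
    intro y hy
    simp only [II, Set.mem_Icc] at hy ⊢
    constructor <;> linarith [hy.1, hy.2, hx.1, hx.2]
  · refine key (-(1/4)) x (by norm_num) ?_
    intro y hy
    simp only [II, Set.mem_Icc] at hy ⊢
    constructor <;> linarith [hy.1, hy.2, hx.1, hx.2]

lemma markov_iter (p : Polynomial ℝ) (n : ℕ) (hn : 1 ≤ n) (hdeg : p.natDegree ≤ n) (M : ℝ)
    (hM : 0 < M) (hP : ∀ x ∈ II, |p.eval x| ≤ M) (i : ℕ) :
    ∀ x ∈ II, |(Polynomial.derivative^[i] p).eval x| ≤ (4 * (n : ℝ) ^ 2) ^ i * M := by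
  induction i with
  | zero => simpa using hP
  | succ i ih =>
    have hn' : (0 : ℝ) < n := by exact_mod_cast hn
    intro x hx
    rw [Function.iterate_succ_apply']
    have := markov_II (Polynomial.derivative^[i] p) n
      ((Polynomial.natDegree_iterate_derivative p i).trans (by omega)) _ (by positivity) ih x hx
    calc _ ≤ _ := this
      _ = _ := by ring

lemma psi_bound (j : ℕ) (p : Polynomial ℝ) (n : ℕ) (hn : 1 ≤ n) (hdeg : p.natDegree ≤ n) (M : ℝ)
    (hM : 0 < M) (hP : ∀ x ∈ II, |p.eval x| ≤ M) (a t : ℝ) (ha : a ∈ II)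
    (ht : |t - a| ≤ 2 / n) :
    |psiP j a p t| ≤ (j + 1) * 8 ^ j * (n : ℝ) ^ j * M := by
  have hn' : (0 : ℝ) < n := by exact_mod_cast hn
  have hn1 : (1 : ℝ) ≤ n := by exact_mod_cast hn
  unfold psiP
  refine (Finset.abs_sum_le_sum_abs _ _).trans ?_
  have : ∀ i ∈ Finset.range (j + 1),
      |(Polynomial.derivative^[i] p).eval a * (t - a) ^ i / (i.factorial : ℝ)|
        ≤ 8 ^ j * (n : ℝ) ^ j * M := by
    intro i hi
    have hi' : i ≤ j := by simpa [Nat.lt_succ_iff] using hi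
    rw [abs_div, abs_mul, abs_pow, Nat.abs_cast]
    have hf : (1 : ℝ) ≤ i.factorial := by exact_mod_cast Nat.one_le_iff_ne_zero.mpr (Nat.factorial_ne_zero i)
    refine (div_le_self (by positivity) hf).trans ?_
    calc _ ≤ ((4 * (n : ℝ) ^ 2) ^ i * M) * (2 / n) ^ i := by
            gcongr
            exact markov_iter p n hn hdeg M hM hP i a ha
      _ = (4 * (n : ℝ) ^ 2 * (2 / n)) ^ i * M := by rw [mul_pow (4 * (n : ℝ) ^ 2) (2 / (n : ℝ)) i, mul_right_comm]
      _ = (8 * (n : ℝ)) ^ i * M := by congr 2; field_simp; norm_num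
      _ ≤ (8 * (n : ℝ)) ^ j * M := by
            gcongr
            linarith
      _ = _ := by rw [mul_pow]
  refine (Finset.sum_le_sum this).trans ?_
  simp
  apply le_of_eq; ring

lemma nikolskii (p : Polynomial ℝ) (n : ℕ) (hn : 1 ≤ n) (hdeg : p.natDegree ≤ n) (x₀ : ℝ)
    (hx₀ : x₀ ∈ II) (hM : 0 < |p.eval x₀|) (hP : ∀ x ∈ II, |p.eval x| ≤ |p.eval x₀|) :
    |p.eval x₀| ^ 2 ≤ 32 * (n : ℝ) ^ 2 * ∫ t in II, (p.eval t) ^ 2 := by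
  have hn' : (0 : ℝ) < n := by exact_mod_cast hn
  have hn1 : (1 : ℝ) ≤ n := by exact_mod_cast hn
  set M := |p.eval x₀| with hMdef
  have hder := markov_II p n hdeg M hM hP
  set δ : ℝ := 1 / (8 * (n : ℝ) ^ 2) with hδ
  have hδ0 : 0 < δ := by positivity
  have hδ1 : δ ≤ 1 / 2 := by
    rw [hδ, div_le_div_iff₀ (by positivity) (by norm_num)]; nlinarith
  obtain ⟨u, hu1, hu2, hu3, hu4⟩ : ∃ u : ℝ, -(1/2) ≤ u ∧ u + δ ≤ 1/2 ∧ u ≤ x₀ ∧ x₀ ≤ u + δ := by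
    simp only [II, Set.mem_Icc] at hx₀
    rcases le_total 0 x₀ with h0 | h0
    · exact ⟨x₀ - δ, by linarith, by linarith, by linarith, by linarith⟩
    · exact ⟨x₀, by linarith, by linarith, by linarith, by linarith⟩
  have hsub : Set.Icc u (u + δ) ⊆ II := Set.Icc_subset_Icc hu1 hu2
  have hlow : ∀ y ∈ Set.Icc u (u + δ), M ^ 2 / 4 ≤ (p.eval y) ^ 2 := by
    intro y hy
    have hmv := Convex.norm_image_sub_le_of_norm_deriv_le (𝕜 := ℝ) (f := fun t => p.eval t)
      (C := 4 * (n : ℝ) ^ 2 * M) (s := II) (x := y) (y := x₀)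
      (fun x _ => p.differentiable.differentiableAt)
      (fun x hx => by rw [Polynomial.deriv, Real.norm_eq_abs]; exact hder x hx)
      (convex_Icc _ _) (hsub hy) hx₀
    simp only [Real.norm_eq_abs] at hmv
    have hd : |x₀ - y| ≤ δ := by rw [abs_le]; constructor <;> linarith [hy.1, hy.2]
    have h1 : 4 * (n : ℝ) ^ 2 * M * |x₀ - y| ≤ 4 * (n : ℝ) ^ 2 * M * δ := by gcongr
    have h2 : 4 * (n : ℝ) ^ 2 * M * δ = M / 2 := by rw [hδ]; field_simp; norm_num
    have h3 : M / 2 ≤ |p.eval y| := by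
      have := abs_sub_abs_le_abs_sub (p.eval x₀) (p.eval y)
      linarith
    rw [← sq_abs (p.eval y)]
    nlinarith
  have hint : IntegrableOn (fun t => (p.eval t) ^ 2) II :=
    (p.continuous.pow 2).continuousOn.integrableOn_Icc
  have h1 : ∫ t in Set.Icc u (u + δ), (p.eval t) ^ 2 ≤ ∫ t in II, (p.eval t) ^ 2 :=
    setIntegral_mono_set hint (ae_of_all _ fun t => sq_nonneg _) hsub.eventuallyLE
  have h2 : ∫ t in Set.Icc u (u + δ), M ^ 2 / 4 ≤ ∫ t in Set.Icc u (u + δ), (p.eval t) ^ 2 :=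
    setIntegral_mono_on (by simp) (hint.mono_set hsub) measurableSet_Icc hlow
  rw [setIntegral_const, Measure.real, Real.volume_Icc, add_sub_cancel_left,
    ENNReal.toReal_ofReal hδ0.le, smul_eq_mul] at h2
  have h3 : 32 * (n : ℝ) ^ 2 * (δ * (M ^ 2 / 4)) = M ^ 2 := by rw [hδ]; field_simp; norm_num
  rw [← h3]
  gcongr
  linarith

lemma trap_bounds (τ a b t : ℝ) (hτ : 0 < τ) (hab : a ≤ b) : |trap τ a b t| ≤ 1 := by
  unfold trap relu
  rw [abs_mul, abs_of_pos (inv_pos.mpr hτ), inv_mul_le_iff₀ hτ, mul_one, abs_le]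
  grind

lemma trap_left (τ a b t : ℝ) (hτ : 0 < τ) (hab : a ≤ b) (h : t ≤ a - τ) : trap τ a b t = 0 := by
  unfold trap relu
  rw [max_eq_right (by linarith), max_eq_right (by linarith), max_eq_right (by linarith),
    max_eq_right (by linarith)]
  simp

lemma trap_right (τ a b t : ℝ) (hτ : 0 < τ) (hab : a ≤ b) (h : b + τ ≤ t) : trap τ a b t = 0 := by
  unfold trap relu
  rw [max_eq_left (by linarith), max_eq_left (by linarith), max_eq_left (by linarith),
    max_eq_left (by linarith)]
  ring

lemma cell_pointwise (j n : ℕ) (hn : 1 ≤ n) (p : Polynomial ℝ) (τ B : ℝ) (hτ : 0 < τ)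
    (hτn : τ ≤ 1 / n) (hB : 0 ≤ B)
    (hpsi : ∀ a t : ℝ, a ∈ II → |t - a| ≤ 2 / n → |psiP j a p t| ≤ B)
    (k' : ℕ) (hk' : k' ∈ Finset.Icc 1 n) (t : ℝ) (ht1 : tk n (k' - 1) ≤ t) (ht2 : t ≤ tk n k') :
    |∑ k ∈ (Finset.Icc 1 n).erase k',
        psiP j (tk n (k - 1)) p t * trap τ (tk n (k - 1)) (tk n k) t| ^ 2 ≤
      (Set.Icc (tk n (k' - 1)) (tk n (k' - 1) + τ) ∪ Set.Icc (tk n k' - τ) (tk n k')).indicator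
        (fun _ => 4 * B ^ 2) t := by
  have hn' : (0 : ℝ) < n := by exact_mod_cast hn
  obtain ⟨hk1, hk2⟩ := Finset.mem_Icc.mp hk'
  have hstep : ∀ k : ℕ, 1 ≤ k → tk n k = tk n (k - 1) + 1 / n := by
    intro k hk
    obtain ⟨m, rfl⟩ : ∃ m, k = m + 1 := ⟨k - 1, by omega⟩
    simp only [tk, Nat.add_sub_cancel]; push_cast; ring
  have hmono : ∀ a b : ℕ, a ≤ b → tk n a ≤ tk n b := by
    intro a b hab
    unfold tk
    have : (a : ℝ) ≤ b := by exact_mod_cast hab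
    gcongr
  have hle : ∀ k : ℕ, tk n (k - 1) ≤ tk n k := fun k => hmono _ _ (by omega)
  have hII : ∀ k : ℕ, k ≤ n → tk n k ∈ II := by
    intro k hk
    have h0 := hmono 0 k (by omega)
    have h1 := hmono k n hk
    have e0 : tk n 0 = -(1/2) := by simp [tk]
    have e1 : tk n n = 1/2 := by unfold tk; rw [div_self hn'.ne']; norm_num
    exact ⟨by linarith, by linarith⟩
  -- each term is bounded
  have hterm : ∀ k ∈ Finset.Icc 1 n,
      |psiP j (tk n (k - 1)) p t * trap τ (tk n (k - 1)) (tk n k) t| ≤ B := by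
    intro k hk
    obtain ⟨ha, hb⟩ := Finset.mem_Icc.mp hk
    by_cases h1 : t ≤ tk n (k - 1) - τ
    · rw [trap_left _ _ _ _ hτ (hle k) h1]; simpa using hB
    by_cases h2 : tk n k + τ ≤ t
    · rw [trap_right _ _ _ _ hτ (hle k) h2]; simpa using hB
    push Not at h1 h2
    rw [abs_mul]
    have hs := hstep k ha
    have h3 : |psiP j (tk n (k - 1)) p t| ≤ B := by
      apply hpsi _ _ (hII _ (by omega))
      have : (2 : ℝ) / n = 1 / n + 1 / n := by ring
      rw [this, abs_le]
      have : (0 : ℝ) < 1 / n := by positivity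
      constructor <;> linarith
    calc _ ≤ B * 1 := mul_le_mul h3 (trap_bounds _ _ _ _ hτ (hle k)) (abs_nonneg _) hB
      _ = B := mul_one B
  have hzero : ∀ k ∈ (Finset.Icc 1 n).erase k', (k = k' + 1 → t < tk n k' - τ) →
      (k = k' - 1 → tk n (k' - 1) + τ < t) → trap τ (tk n (k - 1)) (tk n k) t = 0 := by
    intro k hk hr hl
    obtain ⟨hne, hk⟩ := Finset.mem_erase.mp hk
    obtain ⟨ha, hb⟩ := Finset.mem_Icc.mp hk
    rcases lt_trichotomy k k' with h | h | h
    · apply trap_right _ _ _ _ hτ (hle k)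
      by_cases he : k = k' - 1
      · have := hl he; rw [he]; linarith
      · have h1 := hmono (k + 1) (k' - 1) (by omega)
        have h2 := hstep (k + 1) (by omega)
        simp only [Nat.add_sub_cancel] at h2
        linarith
    · exact absurd h hne
    · apply trap_left _ _ _ _ hτ (hle k)
      by_cases he : k = k' + 1
      · have := hr he; rw [he, Nat.add_sub_cancel]; linarith
      · have h1 := hmono (k' + 1) (k - 1) (by omega)
        have h2 := hstep (k' + 1) (by omega)
        simp only [Nat.add_sub_cancel] at h2
        linarith
  by_cases hS : t ∈ Set.Icc (tk n (k' - 1)) (tk n (k' - 1) + τ) ∪ Set.Icc (tk n k' - τ) (tk n k')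
  · rw [Set.indicator_of_mem hS]
    have hsum : |∑ k ∈ (Finset.Icc 1 n).erase k',
        psiP j (tk n (k - 1)) p t * trap τ (tk n (k - 1)) (tk n k) t| ≤ 2 * B := by
      refine (Finset.abs_sum_le_sum_abs _ _).trans ?_
      calc _ ≤ ∑ k ∈ (Finset.Icc 1 n).erase k', (if k ∈ ({k' - 1, k' + 1} : Finset ℕ) then B else 0) := by
            apply Finset.sum_le_sum
            intro k hk
            split_ifs with h
            · exact hterm k (Finset.mem_of_mem_erase hk)
            · simp only [Finset.mem_insert, Finset.mem_singleton, not_or] at h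
              rw [hzero k hk (fun e => absurd e h.2) (fun e => absurd e h.1)]
              simp
        _ = ∑ k ∈ ((Finset.Icc 1 n).erase k').filter (· ∈ ({k' - 1, k' + 1} : Finset ℕ)), B := by
            rw [Finset.sum_filter]
        _ ≤ ∑ k ∈ ({k' - 1, k' + 1} : Finset ℕ), B := by
            apply Finset.sum_le_sum_of_subset_of_nonneg
            · intro k hk
              exact (Finset.mem_filter.mp hk).2
            · intros; exact hB
        _ ≤ 2 * B := by
            rw [Finset.sum_const, nsmul_eq_mul]
            gcongr
            exact_mod_cast Finset.card_le_two
    calc _ ≤ (2 * B) ^ 2 := by gcongr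
      _ = _ := by ring
  · rw [Set.indicator_of_notMem hS]
    have hS1 : tk n (k' - 1) + τ < t := by
      by_contra h
      exact hS (Or.inl ⟨ht1, not_lt.mp h⟩)
    have hS2 : t < tk n k' - τ := by
      by_contra h
      exact hS (Or.inr ⟨not_lt.mp h, ht2⟩)
    rw [Finset.sum_eq_zero]
    · simp
    · intro k hk
      rw [hzero k hk (fun _ => hS2) (fun _ => hS1), mul_zero]

lemma cell_integral (j n : ℕ) (hn : 1 ≤ n) (p : Polynomial ℝ) (τ B : ℝ) (hτ : 0 < τ)
    (hτn : τ ≤ 1 / n) (hB : 0 ≤ B)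
    (hpsi : ∀ a t : ℝ, a ∈ II → |t - a| ≤ 2 / n → |psiP j a p t| ≤ B)
    (k' : ℕ) (hk' : k' ∈ Finset.Icc 1 n) :
    ∫ t in Ak n k', |∑ k ∈ (Finset.Icc 1 n).erase k',
        psiP j (tk n (k - 1)) p t * trap τ (tk n (k - 1)) (tk n k) t| ^ 2 ≤ 8 * B ^ 2 * τ := by
  set S := Set.Icc (tk n (k' - 1)) (tk n (k' - 1) + τ) ∪ Set.Icc (tk n k' - τ) (tk n k') with hSdef
  have hSm : MeasurableSet S := measurableSet_Icc.union measurableSet_Icc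
  have hSfin : volume S ≤ ENNReal.ofReal (2 * τ) := by
    refine (measure_union_le _ _).trans ?_
    rw [Real.volume_Icc, Real.volume_Icc, ← ENNReal.ofReal_add (by linarith) (by linarith)]
    apply ENNReal.ofReal_le_ofReal
    linarith
  have hSlt : volume S < ⊤ := hSfin.trans_lt ENNReal.ofReal_lt_top
  have hAm : MeasurableSet (Ak n k') := by
    unfold Ak; split_ifs
    · exact measurableSet_Icc
    · exact measurableSet_Ico
  have hA : ∀ t ∈ Ak n k', tk n (k' - 1) ≤ t ∧ t ≤ tk n k' := by
    intro t ht
    unfold Ak at ht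
    split_ifs at ht
    · exact ht
    · exact ⟨ht.1, ht.2.le⟩
  have hgint : Integrable (S.indicator fun _ => 4 * B ^ 2) :=
    (integrable_indicator_iff hSm).mpr (integrableOn_const hSlt.ne)
  calc _ ≤ ∫ t in Ak n k', S.indicator (fun _ => 4 * B ^ 2) t := by
        apply integral_mono_of_nonneg
        · exact ae_of_all _ fun t => by positivity
        · exact hgint.integrableOn
        · refine (ae_restrict_iff' hAm).mpr (ae_of_all _ fun t ht => ?_)
          exact cell_pointwise j n hn p τ B hτ hτn hB hpsi k' hk' t (hA t ht).1 (hA t ht).2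
    _ ≤ ∫ t, S.indicator (fun _ => 4 * B ^ 2) t := by
        apply setIntegral_le_integral hgint
        refine ae_of_all _ fun t => Set.indicator_nonneg (fun _ _ => by positivity) t
    _ = (volume S).toReal * (4 * B ^ 2) := by
        rw [integral_indicator hSm, setIntegral_const, smul_eq_mul, Measure.real]
    _ ≤ (2 * τ) * (4 * B ^ 2) := by
        gcongr
        exact ENNReal.toReal_le_of_le_ofReal (by linarith) hSfin
    _ = _ := by ring

theorem stmt8 (j : ℕ) :
    ∃ C : ℝ, 0 < C ∧ ∀ n s : ℕ, 1 ≤ n → 1 ≤ s → s ≤ n → ∀ τ : ℝ, 0 < τ →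
      τ ≤ (n : ℝ) ^ (-(4 * (j : ℤ)) - 5) → ∀ p : Polynomial ℝ, p.natDegree ≤ s →
      ∑ k' ∈ Finset.Icc 1 n, ∫ t in Ak n k',
          |∑ k ∈ (Finset.Icc 1 n).erase k',
              psiP j (tk n (k - 1)) p t * trap τ (tk n (k - 1)) (tk n k) t| ^ 2
        ≤ C * (n : ℝ) ^ (-(2 * (j : ℤ)) - 2) * ∫ t in II, (p.eval t) ^ 2 := by
  refine ⟨256 * ((j + 1) * 8 ^ j) ^ 2, by positivity, ?_⟩
  intro n s hn hs hsn τ hτ hτn p hp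
  have hn' : (0 : ℝ) < n := by exact_mod_cast hn
  have hn1 : (1 : ℝ) ≤ n := by exact_mod_cast hn
  have hdeg : p.natDegree ≤ n := hp.trans hsn
  by_cases hp0 : p = 0
  · subst hp0
    simp [psiP]
  have hτ1 : τ ≤ 1 / n := by
    refine hτn.trans ?_
    rw [one_div, ← zpow_neg_one]
    exact zpow_le_zpow_right₀ hn1 (by omega)
  obtain ⟨x₀, hx₀, hmax⟩ := (isCompact_Icc (a := (-(1/2) : ℝ)) (b := 1/2)).exists_isMaxOn
    ⟨0, by norm_num, by norm_num⟩ (f := fun t => |p.eval t|) (p.continuous.abs.continuousOn)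
  have hP : ∀ x ∈ II, |p.eval x| ≤ |p.eval x₀| := fun x hx => hmax hx
  have hM : 0 < |p.eval x₀| := by
    by_contra h
    apply hp0
    apply Polynomial.eq_zero_of_infinite_isRoot
    refine (Set.Icc_infinite (show (-(1/2) : ℝ) < 1/2 by norm_num)).mono ?_
    intro x hx
    have := hP x hx
    have h2 : |p.eval x| = 0 := le_antisymm (by linarith) (abs_nonneg _)
    exact abs_eq_zero.mp h2
  have hnik := nikolskii p n hn hdeg x₀ hx₀ hM hP
  set M := |p.eval x₀| with hMdef
  set B : ℝ := (j + 1) * 8 ^ j * (n : ℝ) ^ j * M with hBdef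
  have hB : 0 ≤ B := by positivity
  have hcell := cell_integral j n hn p τ B hτ hτ1 hB
    (fun a t ha ht => psi_bound j p n hn hdeg M hM hP a t ha ht)
  set J := ∫ t in II, (p.eval t) ^ 2 with hJ
  have hJ0 : 0 ≤ J := integral_nonneg fun t => sq_nonneg _
  calc _ ≤ ∑ k' ∈ Finset.Icc 1 n, 8 * B ^ 2 * τ := Finset.sum_le_sum hcell
    _ = 8 * ((j + 1) * 8 ^ j) ^ 2 * (n : ℝ) ^ (2 * j + 1) * τ * M ^ 2 := by
        rw [Finset.sum_const, Nat.card_Icc, Nat.add_sub_cancel, nsmul_eq_mul, hBdef]; ring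
    _ ≤ 8 * ((j + 1) * 8 ^ j) ^ 2 * (n : ℝ) ^ (2 * j + 1) * (n : ℝ) ^ (-(4 * (j : ℤ)) - 5) *
          (32 * (n : ℝ) ^ 2 * J) := by gcongr
    _ = 256 * ((j + 1) * 8 ^ j) ^ 2 * ((n : ℝ) ^ (2 * j + 3) * (n : ℝ) ^ (-(4 * (j : ℤ)) - 5)) * J := by
        ring
    _ = _ := by
        congr 2
        rw [← zpow_natCast, ← zpow_add₀ hn'.ne']
        congr 1
        push_cast; ring
end

section
/- Let j ≥ 0 be an integer. There exists a constant C > 0 depending only on j such that for all integers n, s ≥ 1, every 0 < τ ≤ 1, every polynomial p ∈ P_s, every point a ∈ I, and every t ∈ ℝ with |t − a| ≤ τ + 1/n: |ψ_{j,a,p}(t)| ≤ C · Σ_{j'=0}^{j} (s^{2j'+1} / j'!) (τ + 1/n)^{j'} · ‖p‖_{L²(I)}. -/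
open MeasureTheory

open Polynomial in
lemma aux_A {s : ℕ} {P : ℝ[X]} (hP : P.natDegree ≤ s) {M : ℝ} (hM : 0 < M)
    (hb : ∀ x ∈ Set.Icc (-1 : ℝ) 1, |P.eval x| ≤ M) :
    |(derivative P).eval 1| ≤ (s : ℝ) ^ 2 * M := by
  have key : ∀ c : ℝ, |c| = M⁻¹ → c * (derivative P).eval 1 ≤ (s : ℝ) ^ 2 := by
    intro c hc
    have h := Polynomial.Chebyshev.eval_iterate_derivative_le_of_forall_abs_le_one
      (n := s) (P := C c * P) (k := 1) (x := 1) le_rfl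
      (natDegree_le_iff_degree_le.mp ((natDegree_C_mul_le c P).trans hP))
      (by
        intro x hx
        rw [eval_mul, eval_C, abs_mul, hc, inv_mul_le_iff₀ hM, mul_one]
        exact hb x hx)
    simpa [Polynomial.Chebyshev.derivative_T_eval_one] using h
  have h1 := key M⁻¹ (abs_of_pos (inv_pos.mpr hM))
  have h2 := key (-M⁻¹) (by rw [abs_neg]; exact abs_of_pos (inv_pos.mpr hM))
  rw [inv_mul_le_iff₀ hM] at h1
  rw [neg_mul, ← mul_neg, inv_mul_le_iff₀ hM] at h2
  rw [abs_le]; constructor <;> linarith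

open Polynomial in
lemma aux_B {s : ℕ} (hs : 1 ≤ s) {p : ℝ[X]} (hp : p.natDegree ≤ s) {M : ℝ} (hM : 0 ≤ M)
    (hb : ∀ x ∈ II, |p.eval x| ≤ M) {a : ℝ} (ha : a ∈ II) :
    |(derivative p).eval a| ≤ 4 * (s : ℝ) ^ 2 * M := by
  have hs0 : (0 : ℝ) < (s : ℝ) ^ 2 := by positivity
  simp only [II, Set.mem_Icc] at ha hb
  obtain ⟨r, hr, hrI⟩ : ∃ r : ℝ, |r| = 1 / 4 ∧
      ∀ x ∈ Set.Icc (-1 : ℝ) 1, -(1 / 2) ≤ a + r * (x - 1) ∧ a + r * (x - 1) ≤ 1 / 2 := by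
    rcases le_total 0 a with h | h
    · refine ⟨1 / 4, by norm_num, fun x hx => ?_⟩
      constructor <;> linarith [hx.1, hx.2]
    · refine ⟨-(1 / 4), by norm_num, fun x hx => ?_⟩
      constructor <;> linarith [hx.1, hx.2]
  refine le_of_forall_pos_le_add fun ε hε => ?_
  have hq : (p.comp (C a + C r * (X - 1))).natDegree ≤ s := by
    refine natDegree_comp_le.trans ?_
    have : (C a + C r * (X - 1) : ℝ[X]).natDegree ≤ 1 := by compute_degree
    calc _ ≤ p.natDegree * 1 := Nat.mul_le_mul_left _ this
      _ ≤ s := by simpa using hp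
  have h := aux_A hq (M := M + ε / (4 * s ^ 2)) (by positivity) (by
    intro x hx
    have h1 := hb _ (hrI x hx)
    have h2 : 0 < ε / (4 * s ^ 2) := by positivity
    simp only [eval_comp, eval_add, eval_mul, eval_sub, eval_C, eval_X, eval_one]
    linarith)
  simp only [derivative_comp, eval_comp, eval_add, eval_mul, eval_sub, eval_C, eval_X, eval_one,
    derivative_add, derivative_mul, derivative_C, derivative_sub, derivative_X, derivative_one,
    sub_self, mul_zero, add_zero, zero_mul, zero_add, sub_zero, mul_one, abs_mul, hr] at h
  have h3 : (s : ℝ) ^ 2 * (M + ε / (4 * s ^ 2)) = s ^ 2 * M + ε / 4 := by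
    field_simp
  rw [h3] at h
  linarith

open Polynomial in
lemma aux_C {s : ℕ} (hs : 1 ≤ s) {p : ℝ[X]} (hp : p.natDegree ≤ s) {M : ℝ} (hM : 0 ≤ M)
    (hb : ∀ x ∈ II, |p.eval x| ≤ M) (i : ℕ) :
    ∀ a ∈ II, |(derivative^[i] p).eval a| ≤ (4 * (s : ℝ) ^ 2) ^ i * M := by
  induction i with
  | zero => simpa using hb
  | succ i ih =>
    intro a ha
    rw [Function.iterate_succ_apply']
    have h := aux_B hs (p := derivative^[i] p)
      ((natDegree_iterate_derivative p i).trans ((Nat.sub_le _ _).trans hp))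
      (by positivity) ih ha
    rw [pow_succ]
    linarith

open Polynomial in
lemma aux_D {s : ℕ} (hs : 1 ≤ s) {p : ℝ[X]} (hp : p.natDegree ≤ s) :
    ∀ x ∈ II, |p.eval x| ≤ 6 * s * Real.sqrt (∫ u in II, (p.eval u) ^ 2) := by
  have hcI : IsCompact II := isCompact_Icc
  obtain ⟨x0, hx0, hmax⟩ := hcI.exists_isMaxOn (f := fun x => |p.eval x|)
    ⟨0, by constructor <;> norm_num⟩ (by fun_prop)
  have hb : ∀ x ∈ II, |p.eval x| ≤ |p.eval x0| := fun x hx => hmax hx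
  intro x hx
  refine (hb x hx).trans ?_
  set M := |p.eval x0| with hMdef
  have hM : 0 ≤ M := abs_nonneg _
  have hs1 : (1 : ℝ) ≤ s := by exact_mod_cast hs
  have hs2 : (1 : ℝ) ≤ (s : ℝ) ^ 2 := one_le_pow₀ hs1
  set δ : ℝ := 1 / (8 * s ^ 2) with hδ
  have hδ0 : 0 < δ := by positivity
  have hδ1 : δ ≤ 1 / 8 := by
    rw [hδ]; apply one_div_le_one_div_of_le <;> linarith
  have hδs : 4 * (s : ℝ) ^ 2 * δ = 1 / 2 := by rw [hδ]; field_simp; norm_num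
  obtain ⟨c, hcI', hcx⟩ : ∃ c : ℝ, Set.Icc c (c + δ) ⊆ II ∧
      ∀ y ∈ Set.Icc c (c + δ), |y - x0| ≤ δ := by
    have h0 := hx0
    simp only [II, Set.mem_Icc] at h0
    rcases le_total 0 x0 with h | h
    · refine ⟨x0 - δ, fun y hy => ?_, fun y hy => ?_⟩
      · constructor <;> linarith [hy.1, hy.2]
      · rw [abs_le]; constructor <;> linarith [hy.1, hy.2]
    · refine ⟨x0, fun y hy => ?_, fun y hy => ?_⟩
      · constructor <;> linarith [hy.1, hy.2]
      · rw [abs_le]; constructor <;> linarith [hy.1, hy.2]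
  have hlow : ∀ y ∈ Set.Icc c (c + δ), M ^ 2 / 4 ≤ (p.eval y) ^ 2 := by
    intro y hy
    have hconv : Convex ℝ II := convex_Icc _ _
    have hlip := hconv.norm_image_sub_le_of_norm_hasDerivWithin_le
      (f := fun z => p.eval z) (f' := fun z => (derivative p).eval z) (C := 4 * (s : ℝ) ^ 2 * M)
      (fun z _ => (p.hasDerivAt z).hasDerivWithinAt)
      (fun z hz => by simpa using aux_B hs hp hM hb hz) hx0 (hcI' hy)
    simp only [Real.norm_eq_abs] at hlip
    have h1 : |p.eval y - p.eval x0| ≤ M / 2 := by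
      refine hlip.trans ?_
      calc 4 * (s : ℝ) ^ 2 * M * |y - x0| ≤ 4 * (s : ℝ) ^ 2 * M * δ := by
            gcongr; exact hcx y hy
        _ = (4 * (s : ℝ) ^ 2 * δ) * M := by ring
        _ = M / 2 := by rw [hδs]; ring
    have h2 : M ≤ |p.eval y| + |p.eval y - p.eval x0| := by
      rw [abs_sub_comm]
      have := abs_add_le (p.eval y) (p.eval x0 - p.eval y)
      simpa [hMdef] using this
    have h3 : M / 2 ≤ |p.eval y| := by linarith
    rw [← sq_abs (p.eval y)]
    nlinarith
  have hint : IntegrableOn (fun u => (p.eval u) ^ 2) II :=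
    ContinuousOn.integrableOn_compact hcI (by fun_prop)
  have hI1 : δ * (M ^ 2 / 4) ≤ ∫ u in Set.Icc c (c + δ), (p.eval u) ^ 2 := by
    have := setIntegral_mono_on (μ := volume) (s := Set.Icc c (c + δ)) (f := fun _ => M ^ 2 / 4)
      (g := fun u => (p.eval u) ^ 2) (by simp [integrableOn_const_iff]) (hint.mono_set hcI')
      measurableSet_Icc hlow
    simpa [hδ0.le] using this
  have hI2 : ∫ u in Set.Icc c (c + δ), (p.eval u) ^ 2 ≤ ∫ u in II, (p.eval u) ^ 2 :=
    setIntegral_mono_set hint (Filter.Eventually.of_forall fun u => sq_nonneg _)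
      hcI'.eventuallyLE
  set J := ∫ u in II, (p.eval u) ^ 2
  have hJ : 0 ≤ J := le_trans (by positivity) (hI1.trans hI2)
  have hMJ : M ^ 2 ≤ 32 * s ^ 2 * J := by
    have h := hI1.trans hI2
    have e : M ^ 2 = 32 * (s : ℝ) ^ 2 * (δ * (M ^ 2 / 4)) := by
      rw [hδ]; field_simp; ring
    rw [e]; gcongr
  apply le_of_sq_le_sq _ (by positivity)
  rw [mul_pow, Real.sq_sqrt hJ]
  nlinarith [mul_nonneg (sq_nonneg (s : ℝ)) hJ]

theorem stmt13 (j : ℕ) :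
    ∃ C : ℝ, 0 < C ∧ ∀ n s : ℕ, 1 ≤ n → 1 ≤ s → ∀ τ : ℝ, 0 < τ → τ ≤ 1 →
      ∀ p : Polynomial ℝ, p.natDegree ≤ s → ∀ a ∈ II, ∀ t : ℝ, |t - a| ≤ τ + 1 / (n : ℝ) →
      |psiP j a p t|
        ≤ C * (∑ j' ∈ Finset.range (j + 1),
              (s : ℝ) ^ (2 * j' + 1) / (j'.factorial : ℝ) * (τ + 1 / (n : ℝ)) ^ j') *
            Real.sqrt (∫ u in II, (p.eval u) ^ 2) := by
  refine ⟨6 * 4 ^ j, by positivity, ?_⟩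
  intro n s hn hs τ hτ hτ1 p hp a ha t ht
  set N := Real.sqrt (∫ u in II, (p.eval u) ^ 2)
  have hN : 0 ≤ N := Real.sqrt_nonneg _
  have hC := aux_C hs hp (M := 6 * s * N) (by positivity) (aux_D hs hp)
  unfold psiP
  rw [mul_assoc, Finset.sum_mul, Finset.mul_sum]
  refine (Finset.abs_sum_le_sum_abs _ _).trans (Finset.sum_le_sum fun i hi => ?_)
  have hij : i ≤ j := Nat.lt_succ_iff.mp (Finset.mem_range.mp hi)
  rw [abs_div, abs_mul, abs_pow, Nat.abs_cast]
  have h4 : (4 : ℝ) ^ i ≤ 4 ^ j := pow_le_pow_right₀ (by norm_num) hij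
  calc |(Polynomial.derivative^[i] p).eval a| * |t - a| ^ i / (i.factorial : ℝ)
      ≤ ((4 * (s : ℝ) ^ 2) ^ i * (6 * s * N)) * (τ + 1 / (n : ℝ)) ^ i / (i.factorial : ℝ) := by
        gcongr
        exact hC i a ha
    _ = 4 ^ i * (6 * (s ^ (2 * i + 1) / (i.factorial : ℝ) * (τ + 1 / (n : ℝ)) ^ i * N)) := by
        rw [mul_pow, ← pow_mul, pow_succ]; ring
    _ ≤ 4 ^ j * (6 * (s ^ (2 * i + 1) / (i.factorial : ℝ) * (τ + 1 / (n : ℝ)) ^ i * N)) := by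
        gcongr
    _ = _ := by ring
end
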